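/- Let R be a commutative Noetherian ring, 𝔞 an ideal of R, and N a finitely generated R-module. Then q_𝔞(N) = sup{ q_𝔞(R/𝔭) : 𝔭 ∈ Supp_R(N) }; equivalently, for every integer t, the modules H^i_𝔞(N) are Artinian for all i > t if and only if for every prime 𝔭 ∈ Supp_R(N) the modules H^i_𝔞(R/𝔭) are Artinian for all i > t. -/

import Mathlib

/-!
STATEMENT 16: Let R be a commutative Noetherian ring, 𝔞 an ideal of R, and N a finitely
generated R-module. Then q_𝔞(N) = sup{ q_𝔞(R/𝔭) : 𝔭 ∈ Supp_R(N) } (suprema in `WithBot ℕ∞`,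
with −∞ = ⊥ for empty sets); equivalently, for every integer t, H^i_𝔞(N) is Artinian for all
i > t iff for every prime 𝔭 ∈ Supp_R(N), H^i_𝔞(R/𝔭) is Artinian for all i > t.
-/

open CategoryTheory Opposite

universe u

noncomputable section

namespace ChainComplex

open HomologicalComplex Limits

variable {D : Type*} [Category* D] [Abelian D] (K L : ChainComplex D ℕ) {J : D}

/-- The morphism from the homology of a chain complex induced by a morphism from a term which
vanishes on boundaries. -/
def homologyDesc {n : ℕ} (k : K.X n ⟶ J) (hk : K.d (n + 1) n ≫ k = 0) : K.homology n ⟶ J :=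
  K.homologyι n ≫ K.descOpcycles k (n + 1) (by simp) hk

lemma homologyDesc_surjective [Injective J] {n : ℕ} (φ : K.homology n ⟶ J) :
    ∃ (k : K.X n ⟶ J) (hk : _), K.homologyDesc k hk = φ := by
  refine ⟨K.pOpcycles n ≫ Injective.factorThru φ (K.homologyι n), by simp, ?_⟩
  conv_rhs => rw [← Injective.comp_factorThru φ (K.homologyι n)]
  rw [homologyDesc]
  congr 1
  simp [← cancel_epi (K.pOpcycles n)]

lemma homologyDesc_add {n : ℕ} (k l : K.X n ⟶ J) (hk : K.d (n + 1) n ≫ k = 0)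
    (hl : K.d (n + 1) n ≫ l = 0) (hkl : K.d (n + 1) n ≫ (k + l) = 0) :
    K.homologyDesc (k + l) hkl = K.homologyDesc k hk + K.homologyDesc l hl := by
  simp only [homologyDesc]
  rw [← Preadditive.comp_add]
  congr 1
  simp [← cancel_epi (K.pOpcycles n)]

lemma homologyDesc_eq_zero_iff [Injective J] {n p : ℕ} (hp : p + 1 = n)
    (k : K.X n ⟶ J) (hk : K.d (n + 1) n ≫ k = 0) :
    K.homologyDesc k hk = 0 ↔ ∃ l : K.X p ⟶ J, K.d n p ≫ l = k := by
  constructor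
  · intro h
    let S : ShortComplex D := ShortComplex.mk _ _ (K.homologyι_comp_fromOpcycles n p)
    have hS : S.Exact := S.exact_of_f_is_kernel (K.homologyIsKernel n p (by simp [← hp]))
    refine ⟨hS.descToInjective _ h, ?_⟩
    rw [← K.p_fromOpcycles, Category.assoc]
    have := hS.comp_descToInjective _ h
    dsimp only [S] at this
    rw [this]
    simp
  · rintro ⟨g, rfl⟩
    exact K.homologyι_descOpcycles_eq_zero_of_boundary _ _ _ g rfl

lemma homologyDesc_zero_eq_zero_iff (k : K.X 0 ⟶ J) (hk : K.d 1 0 ≫ k = 0) :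
    K.homologyDesc k hk = 0 ↔ k = 0 := by
  have := K.isIso_homologyι 0 _ rfl (by simp)
  rw [homologyDesc, ← Limits.comp_zero (f := K.homologyι 0), cancel_epi,
    ← cancel_epi (K.pOpcycles 0)]
  simp

variable {K L}

lemma homologyMap_homologyDesc (φ : K ⟶ L) {n : ℕ} (k : L.X n ⟶ J)
    (hk : L.d (n + 1) n ≫ k = 0) :
    homologyMap φ n ≫ L.homologyDesc k hk =
      K.homologyDesc (φ.f n ≫ k) (by rw [← φ.comm_assoc, hk, comp_zero]) := by
  simp [homologyDesc]

end ChainComplex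

namespace CategoryTheory.ProjectiveResolution

variable {R : Type u} [CommRing R] {X X' Y Y' : ModuleCat.{u} R}

variable (R) in
/-- The functor whose left derived functors compute `Ext R (ModuleCat R) n` in its first
argument. -/
abbrev homToFunctor (Y : ModuleCat.{u} R) : ModuleCat.{u} R ⥤ (ModuleCat.{u} R)ᵒᵖ :=
  ((linearYoneda R (ModuleCat.{u} R)).obj Y).rightOp

/-- The chain complex in the opposite category obtained by applying `Hom(-, Y)` to a projective
resolution. -/
def homComplexOp (P : ProjectiveResolution X) (Y : ModuleCat.{u} R) :
    ChainComplex (ModuleCat.{u} R)ᵒᵖ ℕ :=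
  ((homToFunctor R Y).mapHomologicalComplex _).obj P.complex

/-- A cochain, seen as a morphism out of a term of `homComplexOp`. -/
def cochainHom (P : ProjectiveResolution X) {n : ℕ} (f : P.complex.X n ⟶ Y) :
    (P.homComplexOp Y).X n ⟶ op (ModuleCat.of R R) :=
  Quiver.Hom.op (X := ModuleCat.of R R) (Y := ModuleCat.of R (P.complex.X n ⟶ Y))
    (ModuleCat.ofHom (LinearMap.toSpanSingleton R (P.complex.X n ⟶ Y) f))

lemma d_cochainHom (P : ProjectiveResolution X) {n m : ℕ} (f : P.complex.X n ⟶ Y) :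
    (P.homComplexOp Y).d m n ≫ P.cochainHom f = P.cochainHom (P.complex.d m n ≫ f) := by
  apply Quiver.Hom.unop_inj
  ext
  change P.complex.d m n ≫ ((1 : R) • f) = (1 : R) • (P.complex.d m n ≫ f)
  simp

lemma cochainHom_injective (P : ProjectiveResolution X) {n : ℕ} {f g : P.complex.X n ⟶ Y}
    (h : P.cochainHom f = P.cochainHom g) : f = g := by
  have := congr(($h).unop.hom (1 : R))
  change (1 : R) • f = (1 : R) • g at this
  simpa using this

lemma cochainHom_surjective (P : ProjectiveResolution X) {n : ℕ}
    (k : (P.homComplexOp Y).X n ⟶ op (ModuleCat.of R R)) :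
    ∃ f : P.complex.X n ⟶ Y, P.cochainHom f = k := by
  refine ⟨k.unop.hom (1 : R), ?_⟩
  apply Quiver.Hom.unop_inj
  ext
  exact one_smul R _

lemma cochainHom_add (P : ProjectiveResolution X) {n : ℕ} (f g : P.complex.X n ⟶ Y) :
    P.cochainHom (f + g) = P.cochainHom f + P.cochainHom g := by
  apply Quiver.Hom.unop_inj
  ext
  exact smul_add (1 : R) f g

@[simp]
lemma cochainHom_zero (P : ProjectiveResolution X) {n : ℕ} :
    P.cochainHom (0 : P.complex.X n ⟶ Y) = 0 := by
  simpa using P.cochainHom_add (0 : P.complex.X n ⟶ Y) 0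

lemma cochainHom_eq_zero_iff (P : ProjectiveResolution X) {n : ℕ} (f : P.complex.X n ⟶ Y) :
    P.cochainHom f = 0 ↔ f = 0 := by
  constructor
  · intro h
    exact P.cochainHom_injective (h.trans P.cochainHom_zero.symm)
  · rintro rfl
    simp

instance : Injective (op (ModuleCat.of R R)) :=
  have : Projective (ModuleCat.of R R) :=
    ModuleCat.projective_of_free (Module.Basis.singleton Unit R)
  inferInstance

/-- Derived `Hom` computed by a projective resolution, as homology in the opposite category. -/
def leftDerivedHomIso (P : ProjectiveResolution X) (Y : ModuleCat.{u} R) (n : ℕ) :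
    op (((Ext R (ModuleCat.{u} R) n).obj (op X)).obj Y) ≅ (P.homComplexOp Y).homology n :=
  P.isoLeftDerivedObj (homToFunctor R Y) n

/-- Elements of a module as morphisms to `op R` in the opposite category. -/
def elementHom (M : ModuleCat.{u} R) : (op M ⟶ op (ModuleCat.of R R)) ≃+ M where
  toFun φ := φ.unop.hom (1 : R)
  invFun x := (ModuleCat.ofHom (LinearMap.toSpanSingleton R M x)).op
  left_inv φ := by
    apply Quiver.Hom.unop_inj
    ext
    simp
  right_inv x := by simp
  map_add' φ ψ := rfl

lemma elementHom_comp {M N : ModuleCat.{u} R} (f : M ⟶ N) (φ : op M ⟶ op (ModuleCat.of R R)) :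
    elementHom N (f.op ≫ φ) = f (elementHom M φ) := rfl

/-- The class of a cocycle in `Ext R (ModuleCat R) n`. -/
def leftDerivedExtMk (P : ProjectiveResolution X) {n : ℕ} (f : P.complex.X n ⟶ Y)
    (hf : P.complex.d (n + 1) n ≫ f = 0) :
    ((Ext R (ModuleCat.{u} R) n).obj (op X)).obj Y :=
  elementHom _ ((P.leftDerivedHomIso Y n).hom ≫ (P.homComplexOp Y).homologyDesc (P.cochainHom f)
    (by rw [d_cochainHom, hf, cochainHom_zero]))

lemma leftDerivedExtMk_surjective (P : ProjectiveResolution X) {n : ℕ}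
    (x : ((Ext R (ModuleCat.{u} R) n).obj (op X)).obj Y) :
    ∃ (f : P.complex.X n ⟶ Y) (hf : _), P.leftDerivedExtMk f hf = x := by
  obtain ⟨k, hk, hkx⟩ := (P.homComplexOp Y).homologyDesc_surjective
    ((P.leftDerivedHomIso Y n).inv ≫ (elementHom _).symm x)
  obtain ⟨f, rfl⟩ := P.cochainHom_surjective k
  rw [d_cochainHom, cochainHom_eq_zero_iff] at hk
  refine ⟨f, hk, ?_⟩
  rw [leftDerivedExtMk, hkx]
  simp

lemma leftDerivedExtMk_add (P : ProjectiveResolution X) {n : ℕ} (f g : P.complex.X n ⟶ Y)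
    (hf : P.complex.d (n + 1) n ≫ f = 0) (hg : P.complex.d (n + 1) n ≫ g = 0) :
    P.leftDerivedExtMk (f + g) (by simp [hf, hg]) =
      P.leftDerivedExtMk f hf + P.leftDerivedExtMk g hg := by
  simp only [leftDerivedExtMk, ← map_add, ← Preadditive.comp_add, cochainHom_add]
  rw [ChainComplex.homologyDesc_add]

lemma leftDerivedExtMk_eq_zero_iff (P : ProjectiveResolution X) {n p : ℕ} (hp : p + 1 = n)
    (f : P.complex.X n ⟶ Y) (hf : P.complex.d (n + 1) n ≫ f = 0) :
    P.leftDerivedExtMk f hf = 0 ↔ ∃ g : P.complex.X p ⟶ Y, P.complex.d n p ≫ g = f := by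
  rw [leftDerivedExtMk, EmbeddingLike.map_eq_zero_iff,
    ← Limits.comp_zero (f := (P.leftDerivedHomIso Y n).hom), cancel_epi,
    ChainComplex.homologyDesc_eq_zero_iff _ hp]
  constructor
  · rintro ⟨l, hl⟩
    obtain ⟨g, rfl⟩ := P.cochainHom_surjective l
    rw [d_cochainHom] at hl
    exact ⟨g, P.cochainHom_injective hl⟩
  · rintro ⟨g, rfl⟩
    exact ⟨P.cochainHom g, P.d_cochainHom g⟩

lemma leftDerivedExtMk_zero_eq_zero_iff (P : ProjectiveResolution X)
    (f : P.complex.X 0 ⟶ Y) (hf : P.complex.d 1 0 ≫ f = 0) :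
    P.leftDerivedExtMk f hf = 0 ↔ f = 0 := by
  rw [leftDerivedExtMk, EmbeddingLike.map_eq_zero_iff,
    ← Limits.comp_zero (f := (P.leftDerivedHomIso Y 0).hom), cancel_epi,
    ChainComplex.homologyDesc_zero_eq_zero_iff, cochainHom_eq_zero_iff]

/-- The map on `homComplexOp` induced by a morphism of projective resolutions. -/
def homComplexOpMap {P : ProjectiveResolution X} {P' : ProjectiveResolution X'} {g : X ⟶ X'}
    (φ : Hom P P' g) (Y : ModuleCat.{u} R) : P.homComplexOp Y ⟶ P'.homComplexOp Y :=
  ((homToFunctor R Y).mapHomologicalComplex _).map φ.hom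

lemma homComplexOpMap_cochainHom {P : ProjectiveResolution X} {P' : ProjectiveResolution X'}
    {g : X ⟶ X'} (φ : Hom P P' g) {n : ℕ} (f : P'.complex.X n ⟶ Y) :
    (homComplexOpMap φ Y).f n ≫ P'.cochainHom f = P.cochainHom (φ.hom.f n ≫ f) := by
  apply Quiver.Hom.unop_inj
  ext
  change φ.hom.f n ≫ ((1 : R) • f) = (1 : R) • (φ.hom.f n ≫ f)
  simp

lemma leftDerivedHomIso_naturality_left {P : ProjectiveResolution X}
    {P' : ProjectiveResolution X'} {g : X ⟶ X'} (φ : Hom P P' g) (n : ℕ) :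
    (((Ext R (ModuleCat.{u} R) n).map g.op).app Y).op ≫ (P'.leftDerivedHomIso Y n).hom =
      (P.leftDerivedHomIso Y n).hom ≫
        HomologicalComplex.homologyMap (homComplexOpMap φ Y) n :=
  isoLeftDerivedObj_hom_naturality g P P' φ.hom (by simpa using φ.hom_f_zero_comp_π_f_zero)
    (homToFunctor R Y) n

lemma map_app_leftDerivedExtMk {P : ProjectiveResolution X}
    {P' : ProjectiveResolution X'} {g : X ⟶ X'} (φ : Hom P P' g) {n : ℕ}
    (f : P'.complex.X n ⟶ Y) (hf : P'.complex.d (n + 1) n ≫ f = 0) :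
    ((Ext R (ModuleCat.{u} R) n).map g.op).app Y (P'.leftDerivedExtMk f hf) =
      P.leftDerivedExtMk (φ.hom.f n ≫ f) (by simp [← φ.hom.comm_assoc, hf]) := by
  rw [leftDerivedExtMk, ← elementHom_comp, ← Category.assoc, leftDerivedHomIso_naturality_left φ,
    Category.assoc, ChainComplex.homologyMap_homologyDesc, leftDerivedExtMk]
  simp only [homComplexOpMap_cochainHom]

/-- The map on `homComplexOp` induced by a morphism of coefficients. -/
def homComplexOpMapRight (P : ProjectiveResolution X) (g : Y ⟶ Y') :
    P.homComplexOp Y' ⟶ P.homComplexOp Y :=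
  (NatTrans.mapHomologicalComplex (((linearYoneda R (ModuleCat.{u} R)).map g).rightOp) _).app
    P.complex

lemma homComplexOpMapRight_cochainHom (P : ProjectiveResolution X) (g : Y ⟶ Y') {n : ℕ}
    (f : P.complex.X n ⟶ Y) :
    (P.homComplexOpMapRight g).f n ≫ P.cochainHom f = P.cochainHom (f ≫ g) := by
  apply Quiver.Hom.unop_inj
  ext
  change ((1 : R) • f) ≫ g = (1 : R) • (f ≫ g)
  simp

lemma leftDerivedHomIso_naturality_right (P : ProjectiveResolution X) (g : Y ⟶ Y') (n : ℕ) :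
    (((Ext R (ModuleCat.{u} R) n).obj (op X)).map g).op ≫ (P.leftDerivedHomIso Y n).hom =
      (P.leftDerivedHomIso Y' n).hom ≫
        HomologicalComplex.homologyMap (P.homComplexOpMapRight g) n := by
  have : (((Ext R (ModuleCat.{u} R) n).obj (op X)).map g).op =
      (P.leftDerivedHomIso Y' n).hom ≫
        HomologicalComplex.homologyMap (P.homComplexOpMapRight g) n ≫
          (P.leftDerivedHomIso Y n).inv :=
    P.leftDerived_app_eq (((linearYoneda R (ModuleCat.{u} R)).map g).rightOp) n
  simp [this]

lemma map_leftDerivedExtMk (P : ProjectiveResolution X) (g : Y ⟶ Y') {n : ℕ}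
    (f : P.complex.X n ⟶ Y) (hf : P.complex.d (n + 1) n ≫ f = 0) :
    ((Ext R (ModuleCat.{u} R) n).obj (op X)).map g (P.leftDerivedExtMk f hf) =
      P.leftDerivedExtMk (f ≫ g) (by simp [reassoc_of% hf]) := by
  rw [leftDerivedExtMk, ← elementHom_comp, ← Category.assoc, leftDerivedHomIso_naturality_right,
    Category.assoc, ChainComplex.homologyMap_homologyDesc, leftDerivedExtMk]
  simp only [homComplexOpMapRight_cochainHom]

lemma elementHom_smul {M : ModuleCat.{u} R} (φ : op M ⟶ op (ModuleCat.of R R)) (r : R) :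
    elementHom M (φ ≫ (r • 𝟙 (ModuleCat.of R R)).op) = r • elementHom M φ := by
  exact map_smul φ.unop.hom r (1 : R)

lemma leftDerivedExtMk_smul (P : ProjectiveResolution X) {n : ℕ} (f : P.complex.X n ⟶ Y)
    (hf : P.complex.d (n + 1) n ≫ f = 0) (r : R) :
    P.leftDerivedExtMk (r • f) (by simp [hf]) = r • P.leftDerivedExtMk f hf := by
  have : P.cochainHom (r • f) = P.cochainHom f ≫ (r • 𝟙 (ModuleCat.of R R)).op := by
    apply Quiver.Hom.unop_inj
    ext
    change (1 : R) • (r • f) = (r • (1 : R)) • f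
    simp
  simp only [leftDerivedExtMk, ← elementHom_smul, Category.assoc, ChainComplex.homologyDesc,
    HomologicalComplex.descOpcycles_comp, this]

lemma extMk_zero_eq_zero_iff (P : ProjectiveResolution X) (f : P.complex.X 0 ⟶ Y)
    (hf : P.complex.d 1 0 ≫ f = 0) :
    P.extMk f 1 rfl hf = 0 ↔ f = 0 := by
  constructor
  · intro h
    rw [← P.extEquivCohomologyClass.apply_eq_iff_eq, extEquivCohomologyClass_extMk,
      extEquivCohomologyClass_zero, CochainComplex.HomComplex.CohomologyClass.mk_eq_zero_iff,
      CochainComplex.HomComplex.Cocycle.toSingleMk_mem_coboundaries_iff _ _ _ _ _ 1 (by simp)] at h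
    obtain ⟨g, hg⟩ := h
    have hd : P.cochainComplex.d (-((0 : ℕ) : ℤ)) 1 = 0 := by
      apply Limits.IsZero.eq_of_tgt
      exact CochainComplex.isZero_of_isStrictlyLE _ 0 1
    rw [hd, Limits.zero_comp] at hg
    rw [← cancel_epi (P.cochainComplexXIso (-((0 : ℕ) : ℤ)) 0 rfl).hom, ← hg, Limits.comp_zero]
  · rintro rfl
    simp

lemma extMk_eq_zero_iff_leftDerivedExtMk_eq_zero (P : ProjectiveResolution X) {n : ℕ}
    (f : P.complex.X n ⟶ Y) (hf : P.complex.d (n + 1) n ≫ f = 0) :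
    P.extMk f (n + 1) rfl hf = 0 ↔ P.leftDerivedExtMk f hf = 0 := by
  cases n with
  | zero => rw [leftDerivedExtMk_zero_eq_zero_iff, extMk_zero_eq_zero_iff]
  | succ p => rw [P.leftDerivedExtMk_eq_zero_iff rfl, P.extMk_eq_zero_iff _ _ _ _ p rfl]

/-- The submodule of cocycles of degree `n` with values in `Y`. -/
def cocycles (P : ProjectiveResolution X) (Y : ModuleCat.{u} R) (n : ℕ) :
    Submodule R (P.complex.X n ⟶ Y) where
  carrier := { f | P.complex.d (n + 1) n ≫ f = 0 }
  add_mem' hf hg := by simp_all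
  zero_mem' := by simp
  smul_mem' r f hf := by simp_all

lemma extMk_smul (P : ProjectiveResolution X) {n : ℕ} (f : P.complex.X n ⟶ Y)
    (hf : P.complex.d (n + 1) n ≫ f = 0) (r : R) :
    P.extMk (r • f) (n + 1) rfl (by simp [hf]) = r • P.extMk f (n + 1) rfl hf := by
  rw [Abelian.Ext.smul_eq_comp_mk₀, extMk_comp_mk₀]
  simp

/-- `extMk` as a linear map. -/
def extMkLinear (P : ProjectiveResolution X) (Y : ModuleCat.{u} R) (n : ℕ) :
    P.cocycles Y n →ₗ[R] Abelian.Ext X Y n where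
  toFun f := P.extMk f.1 (n + 1) rfl f.2
  map_add' f g := (P.add_extMk f.1 g.1 (n + 1) rfl f.2 g.2).symm
  map_smul' r f := P.extMk_smul f.1 f.2 r

lemma extMkLinear_surjective (P : ProjectiveResolution X) (Y : ModuleCat.{u} R) (n : ℕ) :
    Function.Surjective (P.extMkLinear Y n) := fun α ↦ by
  obtain ⟨f, hf, rfl⟩ := P.extMk_surjective α (n + 1) rfl
  exact ⟨⟨f, hf⟩, rfl⟩

/-- `leftDerivedExtMk` as a linear map. -/
def leftDerivedExtMkLinear (P : ProjectiveResolution X) (Y : ModuleCat.{u} R) (n : ℕ) :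
    P.cocycles Y n →ₗ[R] ((Ext R (ModuleCat.{u} R) n).obj (op X)).obj Y where
  toFun f := P.leftDerivedExtMk f.1 f.2
  map_add' f g := P.leftDerivedExtMk_add f.1 g.1 f.2 g.2
  map_smul' r f := P.leftDerivedExtMk_smul f.1 f.2 r

lemma leftDerivedExtMkLinear_surjective (P : ProjectiveResolution X) (Y : ModuleCat.{u} R)
    (n : ℕ) : Function.Surjective (P.leftDerivedExtMkLinear Y n) := fun x ↦ by
  obtain ⟨f, hf, rfl⟩ := P.leftDerivedExtMk_surjective x
  exact ⟨⟨f, hf⟩, rfl⟩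

/-- The comparison between the `Ext` of the derived category and the left derived functors of
`Hom`. -/
def extLinearEquiv (P : ProjectiveResolution X) (Y : ModuleCat.{u} R) (n : ℕ) :
    Abelian.Ext X Y n ≃ₗ[R] ((Ext R (ModuleCat.{u} R) n).obj (op X)).obj Y :=
  ((P.extMkLinear Y n).quotKerEquivOfSurjective (P.extMkLinear_surjective Y n)).symm ≪≫ₗ
    Submodule.quotEquivOfEq _ _ (by
      ext f
      exact P.extMk_eq_zero_iff_leftDerivedExtMk_eq_zero f.1 f.2) ≪≫ₗ
    (P.leftDerivedExtMkLinear Y n).quotKerEquivOfSurjective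
      (P.leftDerivedExtMkLinear_surjective Y n)

lemma extLinearEquiv_extMk (P : ProjectiveResolution X) {n : ℕ} (f : P.complex.X n ⟶ Y)
    (hf : P.complex.d (n + 1) n ≫ f = 0) :
    P.extLinearEquiv Y n (P.extMk f (n + 1) rfl hf) = P.leftDerivedExtMk f hf := by
  have : P.extMk f (n + 1) rfl hf = P.extMkLinear Y n ⟨f, hf⟩ := rfl
  rw [this, extLinearEquiv, LinearEquiv.trans_apply, LinearEquiv.trans_apply,
    LinearMap.quotKerEquivOfSurjective_symm_apply]
  rfl

lemma extLinearEquiv_comp_mk₀ (P : ProjectiveResolution X) {n : ℕ} (α : Abelian.Ext X Y n)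
    (g : Y ⟶ Y') :
    P.extLinearEquiv Y' n (α.comp (Abelian.Ext.mk₀ g) (add_zero n)) =
      ((Ext R (ModuleCat.{u} R) n).obj (op X)).map g (P.extLinearEquiv Y n α) := by
  obtain ⟨f, hf, rfl⟩ := P.extMk_surjective α (n + 1) rfl
  rw [extMk_comp_mk₀, extLinearEquiv_extMk, extLinearEquiv_extMk, map_leftDerivedExtMk]

lemma extLinearEquiv_mk₀_comp (P : ProjectiveResolution X) (P' : ProjectiveResolution X') {n : ℕ}
    (α : Abelian.Ext X' Y n) (g : X ⟶ X') :
    P.extLinearEquiv Y n ((Abelian.Ext.mk₀ g).comp α (zero_add n)) =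
      ((Ext R (ModuleCat.{u} R) n).map g.op).app Y (P'.extLinearEquiv Y n α) := by
  obtain ⟨f, hf, rfl⟩ := P'.extMk_surjective α (n + 1) rfl
  let φ : Hom P P' g := ⟨lift g P P', HomologicalComplex.congr_hom (lift_commutes g P P') 0⟩
  rw [mk₀_comp_extMk _ _ _ _ φ, extLinearEquiv_extMk, extLinearEquiv_extMk,
    map_app_leftDerivedExtMk φ]

end CategoryTheory.ProjectiveResolution

namespace localCohomology

open CategoryTheory.Limits CategoryTheory.Abelian

variable {R : Type u} [CommRing R] (𝔞 : Ideal R)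

/-- The module `R ⧸ 𝔞 ^ n`. -/
abbrev quotPow (n : ℕ) : ModuleCat.{u} R := ModuleCat.of R (R ⧸ 𝔞 ^ n)

/-- The projection `R ⧸ 𝔞 ^ m ⟶ R ⧸ 𝔞 ^ n`. -/
def quotPowMap {n m : ℕ} (h : n ≤ m) : quotPow 𝔞 m ⟶ quotPow 𝔞 n :=
  (ringModIdeals (idealPowersDiagram 𝔞)).map (homOfLE h).op

variable (M M' : ModuleCat.{u} R) (i : ℕ)

/-- The terms of the directed system computing local cohomology. -/
abbrev extObj (n : ℕ) : ModuleCat.{u} R :=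
  ((_root_.Ext R (ModuleCat.{u} R) i).obj (op (quotPow 𝔞 n))).obj M

/-- The transition maps of the directed system computing local cohomology. -/
def extObjMap {n m : ℕ} (h : n ≤ m) : extObj 𝔞 M i n ⟶ extObj 𝔞 M i m :=
  ((_root_.Ext R (ModuleCat.{u} R) i).map (quotPowMap 𝔞 h).op).app M

/-- The local cohomology of `M` as a module. -/
abbrev lc : ModuleCat.{u} R := (localCohomology 𝔞 i).obj M

/-- The canonical maps to local cohomology. -/
def extObjι (n : ℕ) : extObj 𝔞 M i n ⟶ lc 𝔞 M i :=
  (colimit.ι (diagram (idealPowersDiagram 𝔞) i) (op (op n))).app M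

lemma extObjMap_extObjι {n m : ℕ} (h : n ≤ m) :
    extObjMap 𝔞 M i h ≫ extObjι 𝔞 M i m = extObjι 𝔞 M i n :=
  congr_app (colimit.w (diagram (idealPowersDiagram 𝔞) i) (homOfLE h).op.op) M

/-- The colimit cocone computing the local cohomology of `M`. -/
def isColimitEvaluation :
    IsColimit (((evaluation _ _).obj M).mapCocone
      (colimit.cocone (diagram (idealPowersDiagram 𝔞) i))) :=
  isColimitOfPreserves ((evaluation _ _).obj M) (colimit.isColimit _)

lemma preservesFilteredColimitsOfSize_forget :
    PreservesFilteredColimitsOfSize.{0, 0} (forget (ModuleCat.{u} R)) :=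
  preservesFilteredColimitsOfSize_shrink.{0, u, 0, u} _

lemma extObjι_jointly_surjective (x : lc 𝔞 M i) :
    ∃ (n : ℕ) (y : extObj 𝔞 M i n), (extObjι 𝔞 M i n).hom y = x := by
  have := preservesFilteredColimitsOfSize_forget (R := R)
  obtain ⟨j, y, hy⟩ := Concrete.isColimit_exists_rep _ (isColimitEvaluation 𝔞 M i) x
  exact ⟨j.unop.unop, y, hy⟩

lemma exists_extObjMap_eq_zero {n : ℕ} (y : extObj 𝔞 M i n) (hy : (extObjι 𝔞 M i n).hom y = 0) :
    ∃ (m : ℕ) (h : n ≤ m), (extObjMap 𝔞 M i h).hom y = 0 := by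
  have := preservesFilteredColimitsOfSize_forget (R := R)
  obtain ⟨k, f, g, hfg⟩ := Concrete.isColimit_exists_of_rep_eq
    (diagram (idealPowersDiagram 𝔞) i ⋙ (evaluation _ _).obj M) (isColimitEvaluation 𝔞 M i)
    (i := op (op n)) (j := op (op n)) y (0 : extObj 𝔞 M i n)
    (hy.trans (map_zero (extObjι 𝔞 M i n).hom).symm)
  refine ⟨k.unop.unop, leOfHom f.unop.unop, ?_⟩
  exact hfg.trans (map_zero (extObjMap 𝔞 M i (leOfHom g.unop.unop)).hom)

variable {M M'} in
lemma extObjι_naturality (f : M ⟶ M') (n : ℕ) :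
    extObjι 𝔞 M i n ≫ (localCohomology 𝔞 i).map f =
      ((_root_.Ext R (ModuleCat.{u} R) i).obj (op (quotPow 𝔞 n))).map f ≫ extObjι 𝔞 M' i n :=
  ((colimit.ι (diagram (idealPowersDiagram 𝔞) i) (op (op n))).naturality f).symm

lemma exists_extObjι_comp_eq {T : ModuleCat.{u} R} (φ : ∀ n, extObj 𝔞 M i n ⟶ T)
    (hφ : ∀ (n m : ℕ) (h : n ≤ m), extObjMap 𝔞 M i h ≫ φ m = φ n) :
    ∃ ψ : lc 𝔞 M i ⟶ T, ∀ n, extObjι 𝔞 M i n ≫ ψ = φ n := by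
  let c : Cocone (diagram (idealPowersDiagram 𝔞) i ⋙ (evaluation _ _).obj M) :=
    { pt := T
      ι :=
        { app j := φ j.unop.unop
          naturality j k f := (hφ j.unop.unop k.unop.unop (leOfHom f.unop.unop)).trans
            (Category.comp_id _).symm } }
  exact ⟨(isColimitEvaluation 𝔞 M i).desc c,
    fun n ↦ (isColimitEvaluation 𝔞 M i).fac c (op (op n))⟩

variable {𝔞 i M M'}

variable (𝔞 M i) in
/-- The comparison of the terms of the directed system with `Ext` in the derived category. -/
def extEquiv (n : ℕ) : Ext (quotPow 𝔞 n) M i ≃ₗ[R] extObj 𝔞 M i n :=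
  (projectiveResolution (quotPow 𝔞 n)).extLinearEquiv M i

/-- The canonical map from `Ext` to local cohomology. -/
def ofExt (n : ℕ) : Ext (quotPow 𝔞 n) M i →ₗ[R] lc 𝔞 M i :=
  (extObjι 𝔞 M i n).hom ∘ₗ (extEquiv 𝔞 M i n).toLinearMap

lemma extEquiv_mk₀_comp {n m : ℕ} (h : n ≤ m) (α : Ext (quotPow 𝔞 n) M i) :
    extEquiv 𝔞 M i m ((Ext.mk₀ (quotPowMap 𝔞 h)).comp α (zero_add i)) =
      (extObjMap 𝔞 M i h).hom (extEquiv 𝔞 M i n α) :=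
  ProjectiveResolution.extLinearEquiv_mk₀_comp _ (projectiveResolution (quotPow 𝔞 n)) _ _

lemma ofExt_surjective (x : lc 𝔞 M i) :
    ∃ (n : ℕ) (α : Ext (quotPow 𝔞 n) M i), ofExt n α = x := by
  obtain ⟨n, y, hy⟩ := extObjι_jointly_surjective 𝔞 M i x
  obtain ⟨α, rfl⟩ := (extEquiv 𝔞 M i n).surjective y
  exact ⟨_, α, hy⟩

lemma ofExt_quotPowMap {n m : ℕ} (h : n ≤ m) (α : Ext (quotPow 𝔞 n) M i) :
    ofExt m ((Ext.mk₀ (quotPowMap 𝔞 h)).comp α (zero_add i)) = ofExt n α := by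
  rw [ofExt, LinearMap.comp_apply, LinearEquiv.coe_coe, extEquiv_mk₀_comp]
  exact congr(($(extObjMap_extObjι 𝔞 M i h)).hom _)

lemma exists_comp_eq_zero_of_ofExt_eq_zero {n : ℕ} (α : Ext (quotPow 𝔞 n) M i)
    (hα : ofExt n α = 0) :
    ∃ (m : ℕ) (h : n ≤ m), (Ext.mk₀ (quotPowMap 𝔞 h)).comp α (zero_add i) = 0 := by
  obtain ⟨m, h, hm⟩ := exists_extObjMap_eq_zero 𝔞 M i (extEquiv 𝔞 M i n α) hα
  refine ⟨m, h, (extEquiv 𝔞 M i m).injective ?_⟩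
  rw [extEquiv_mk₀_comp, map_zero, hm]

lemma map_ofExt (f : M ⟶ M') {n : ℕ} (α : Ext (quotPow 𝔞 n) M i) :
    ((localCohomology 𝔞 i).map f).hom (ofExt n α) =
      ofExt n (α.comp (Ext.mk₀ f) (add_zero i)) := by
  have h1 : extEquiv 𝔞 M' i n (α.comp (Ext.mk₀ f) (add_zero i)) =
      (((_root_.Ext R (ModuleCat.{u} R) i).obj (op (quotPow 𝔞 n))).map f).hom
        (extEquiv 𝔞 M i n α) :=
    ProjectiveResolution.extLinearEquiv_comp_mk₀ _ _ _
  rw [ofExt, ofExt, LinearMap.comp_apply, LinearMap.comp_apply, LinearEquiv.coe_coe,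
    LinearEquiv.coe_coe, h1]
  exact congr(($(extObjι_naturality 𝔞 i f n)).hom _)

lemma exists_linearMap_of_compatible {T : Type u} [AddCommGroup T] [Module R T]
    (φ : ∀ n, Ext (quotPow 𝔞 n) M i →ₗ[R] T)
    (hφ : ∀ (n m : ℕ) (h : n ≤ m) (α : Ext (quotPow 𝔞 n) M i),
      φ m ((Ext.mk₀ (quotPowMap 𝔞 h)).comp α (zero_add i)) = φ n α) :
    ∃ ψ : lc 𝔞 M i →ₗ[R] T, ∀ n α, ψ (ofExt n α) = φ n α := by
  obtain ⟨ψ, hψ⟩ := exists_extObjι_comp_eq 𝔞 M i (T := ModuleCat.of R T)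
    (fun n ↦ ModuleCat.ofHom (φ n ∘ₗ (extEquiv 𝔞 M i n).symm.toLinearMap)) (fun n m h ↦ by
      ext x
      obtain ⟨α, rfl⟩ := (extEquiv 𝔞 M i n).surjective x
      change φ m ((extEquiv 𝔞 M i m).symm ((extObjMap 𝔞 M i h).hom (extEquiv 𝔞 M i n α))) =
        φ n ((extEquiv 𝔞 M i n).symm (extEquiv 𝔞 M i n α))
      rw [← extEquiv_mk₀_comp, LinearEquiv.symm_apply_apply, LinearEquiv.symm_apply_apply, hφ])
  refine ⟨ψ.hom, fun n α ↦ ?_⟩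
  have : ψ.hom ((extObjι 𝔞 M i n).hom (extEquiv 𝔞 M i n α)) =
      φ n ((extEquiv 𝔞 M i n).symm (extEquiv 𝔞 M i n α)) :=
    congr(($(hψ n)).hom (extEquiv 𝔞 M i n α))
  rwa [LinearEquiv.symm_apply_apply] at this

end localCohomology

namespace localCohomology

open CategoryTheory.Limits CategoryTheory.Abelian

variable {R : Type u} [CommRing R] {𝔞 : Ideal R}

section ShortExact

variable {S : ShortComplex (ModuleCat.{u} R)}

lemma exact_map (hS : S.ShortExact) (i : ℕ) :
    Function.Exact ((localCohomology 𝔞 i).map S.f).hom ((localCohomology 𝔞 i).map S.g).hom := by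
  intro x
  constructor
  · intro hx
    obtain ⟨n, α, rfl⟩ := ofExt_surjective x
    rw [map_ofExt] at hx
    obtain ⟨m, h, hm⟩ := exists_comp_eq_zero_of_ofExt_eq_zero _ hx
    rw [← Ext.comp_assoc_of_third_deg_zero] at hm
    obtain ⟨β, hβ⟩ := Ext.covariant_sequence_exact₂ _ hS _ hm
    refine ⟨ofExt m β, ?_⟩
    rw [map_ofExt, hβ, ofExt_quotPowMap]
  · rintro ⟨y, rfl⟩
    obtain ⟨n, β, rfl⟩ := ofExt_surjective y
    rw [map_ofExt, map_ofExt, Ext.comp_assoc_of_third_deg_zero, Ext.mk₀_comp_mk₀, S.zero,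
      Ext.mk₀_zero, Ext.comp_zero, map_zero]

lemma exists_connecting (hS : S.ShortExact) (i : ℕ) :
    ∃ δ : lc 𝔞 S.X₃ i →ₗ[R] lc 𝔞 S.X₁ (i + 1),
      Function.Exact ((localCohomology 𝔞 i).map S.g).hom δ ∧
        Function.Exact δ ((localCohomology 𝔞 (i + 1)).map S.f).hom := by
  obtain ⟨δ, hδ⟩ := exists_linearMap_of_compatible (𝔞 := 𝔞) (M := S.X₃) (i := i)
    (T := lc 𝔞 S.X₁ (i + 1))
    (fun n ↦ ofExt n ∘ₗ Ext.postcompOfLinear hS.extClass R (quotPow 𝔞 n) rfl) (fun n m h α ↦ by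
      change ofExt m (((Ext.mk₀ (quotPowMap 𝔞 h)).comp α (zero_add i)).comp hS.extClass rfl) =
        ofExt n (α.comp hS.extClass rfl)
      rw [Ext.comp_assoc _ _ _ (zero_add i) rfl (by lia), ofExt_quotPowMap])
  replace hδ (n : ℕ) (α : Ext (quotPow 𝔞 n) S.X₃ i) :
      δ (ofExt n α) = ofExt n (α.comp hS.extClass rfl) := hδ n α
  refine ⟨δ, fun x ↦ ⟨fun hx ↦ ?_, ?_⟩, fun x ↦ ⟨fun hx ↦ ?_, ?_⟩⟩
  · obtain ⟨n, α, rfl⟩ := ofExt_surjective x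
    rw [hδ] at hx
    obtain ⟨m, h, hm⟩ := exists_comp_eq_zero_of_ofExt_eq_zero _ hx
    rw [← Ext.comp_assoc _ _ _ (zero_add i) rfl (by lia)] at hm
    obtain ⟨β, hβ⟩ := Ext.covariant_sequence_exact₃ _ hS _ rfl hm
    refine ⟨ofExt m β, ?_⟩
    rw [map_ofExt, hβ, ofExt_quotPowMap]
  · rintro ⟨y, rfl⟩
    obtain ⟨n, β, rfl⟩ := ofExt_surjective y
    rw [map_ofExt, hδ, Ext.comp_assoc _ _ _ (add_zero i) (zero_add 1) (by lia), hS.comp_extClass,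
      Ext.comp_zero, map_zero]
  · obtain ⟨n, α, rfl⟩ := ofExt_surjective x
    rw [map_ofExt] at hx
    obtain ⟨m, h, hm⟩ := exists_comp_eq_zero_of_ofExt_eq_zero _ hx
    rw [← Ext.comp_assoc_of_third_deg_zero] at hm
    obtain ⟨β, hβ⟩ := Ext.covariant_sequence_exact₁ _ hS _ hm rfl
    refine ⟨ofExt m β, ?_⟩
    rw [hδ, hβ, ofExt_quotPowMap]
  · rintro ⟨y, rfl⟩
    obtain ⟨n, β, rfl⟩ := ofExt_surjective y
    rw [hδ, map_ofExt, Ext.comp_assoc _ _ _ rfl (add_zero 1) (by lia), hS.extClass_comp,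
      Ext.comp_zero, map_zero]

end ShortExact

section Module

variable {M N P : Type u} [AddCommGroup M] [Module R M] [AddCommGroup N] [Module R N]
  [AddCommGroup P] [Module R P]

variable (𝔞 M) in
/-- The local cohomology of an unbundled module. -/
abbrev H (i : ℕ) : ModuleCat.{u} R := (localCohomology 𝔞 i).obj (ModuleCat.of R M)

variable (𝔞) in
/-- The linear map induced on local cohomology. -/
def mapH (i : ℕ) (f : M →ₗ[R] N) : H 𝔞 M i →ₗ[R] H 𝔞 N i :=
  ((localCohomology 𝔞 i).map (ModuleCat.ofHom f)).hom

lemma shortExact_of_exact {f : M →ₗ[R] N} {g : N →ₗ[R] P} (hf : Function.Injective f)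
    (hg : Function.Surjective g) (hfg : Function.Exact f g) :
    (ShortComplex.mk (ModuleCat.ofHom f) (ModuleCat.ofHom g)
      (by rw [← ModuleCat.ofHom_comp, hfg.linearMap_comp_eq_zero,
        ModuleCat.ofHom_zero])).ShortExact where
  exact := (ShortComplex.ShortExact.moduleCat_exact_iff_function_exact _).2 hfg
  mono_f := (ModuleCat.mono_iff_injective _).2 hf
  epi_g := (ModuleCat.epi_iff_surjective _).2 hg

variable {f : M →ₗ[R] N} {g : N →ₗ[R] P}

lemma exact_mapH (hf : Function.Injective f) (hg : Function.Surjective g)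
    (hfg : Function.Exact f g) (i : ℕ) : Function.Exact (mapH 𝔞 i f) (mapH 𝔞 i g) :=
  exact_map (shortExact_of_exact hf hg hfg) i

lemma exists_connecting_mapH (hf : Function.Injective f) (hg : Function.Surjective g)
    (hfg : Function.Exact f g) (i : ℕ) :
    ∃ δ : H 𝔞 P i →ₗ[R] H 𝔞 M (i + 1),
      Function.Exact (mapH 𝔞 i g) δ ∧ Function.Exact δ (mapH 𝔞 (i + 1) f) :=
  exists_connecting (shortExact_of_exact hf hg hfg) i

lemma isArtinian_of_exact {A B C : Type*} [AddCommGroup A] [Module R A] [AddCommGroup B]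
    [Module R B] [AddCommGroup C] [Module R C] (f : A →ₗ[R] B) (g : B →ₗ[R] C)
    (hfg : Function.Exact f g) [IsArtinian R A] [IsArtinian R C] : IsArtinian R B := by
  refine isArtinian_of_range_eq_ker f.range.subtype g.rangeRestrict ?_
  rw [Submodule.range_subtype, LinearMap.ker_rangeRestrict, hfg.linearMap_ker_eq]

lemma subsingleton_of_exact {A B C : Type*} [AddCommGroup A] [Module R A] [AddCommGroup B]
    [Module R B] [AddCommGroup C] [Module R C] (f : A →ₗ[R] B) (g : B →ₗ[R] C)
    (hfg : Function.Exact f g) [Subsingleton A] [Subsingleton C] : Subsingleton B := by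
  refine subsingleton_of_forall_eq 0 fun b ↦ ?_
  obtain ⟨a, rfl⟩ := (hfg b).1 (Subsingleton.elim _ _)
  rw [Subsingleton.elim a 0, map_zero]

lemma isArtinian_H_middle (hf : Function.Injective f) (hg : Function.Surjective g)
    (hfg : Function.Exact f g) {i : ℕ} (hM : IsArtinian R (H 𝔞 M i))
    (hP : IsArtinian R (H 𝔞 P i)) : IsArtinian R (H 𝔞 N i) :=
  isArtinian_of_exact _ _ (exact_mapH hf hg hfg i)

lemma isArtinian_H_right (hf : Function.Injective f) (hg : Function.Surjective g)
    (hfg : Function.Exact f g) {i : ℕ} (hN : IsArtinian R (H 𝔞 N i))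
    (hM : IsArtinian R (H 𝔞 M (i + 1))) : IsArtinian R (H 𝔞 P i) :=
  have ⟨_, hδ, _⟩ := exists_connecting_mapH hf hg hfg i
  isArtinian_of_exact _ _ hδ

lemma subsingleton_H_middle (hf : Function.Injective f) (hg : Function.Surjective g)
    (hfg : Function.Exact f g) {i : ℕ} (hM : Subsingleton (H 𝔞 M i))
    (hP : Subsingleton (H 𝔞 P i)) : Subsingleton (H 𝔞 N i) :=
  subsingleton_of_exact _ _ (exact_mapH hf hg hfg i)

lemma subsingleton_H_left (hf : Function.Injective f) (hg : Function.Surjective g)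
    (hfg : Function.Exact f g) {i : ℕ} (hP : Subsingleton (H 𝔞 P i))
    (hN : Subsingleton (H 𝔞 N (i + 1))) : Subsingleton (H 𝔞 M (i + 1)) :=
  have ⟨_, _, hδ⟩ := exists_connecting_mapH hf hg hfg i
  subsingleton_of_exact _ _ hδ

/-- Local cohomology of isomorphic modules. -/
def equivH (e : M ≃ₗ[R] N) (i : ℕ) : H 𝔞 M i ≃ₗ[R] H 𝔞 N i :=
  ((localCohomology 𝔞 i).mapIso e.toModuleIso).toLinearEquiv

lemma subsingleton_H_of_forall_ext {i : ℕ}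
    (h : ∀ n, Subsingleton (Ext (quotPow 𝔞 n) (ModuleCat.of R M) i)) :
    Subsingleton (H 𝔞 M i) := by
  refine subsingleton_of_forall_eq 0 fun x ↦ ?_
  obtain ⟨n, α, rfl⟩ := ofExt_surjective x
  rw [Subsingleton.elim α 0, map_zero]

end Module

end localCohomology

namespace localCohomology

open CategoryTheory.Limits CategoryTheory.Abelian

variable {R : Type u} [CommRing R] {𝔞 𝔟 : Ideal R}
  {M N P : Type u} [AddCommGroup M] [Module R M] [AddCommGroup N] [Module R N]
  [AddCommGroup P] [Module R P]

variable (𝔞 M) in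
/-- Every element of `M` is annihilated by a power of each element of `𝔞`. -/
def IsPowerTorsion : Prop :=
  ∀ m : M, 𝔞 ≤ (Ideal.torsionOf R M m).radical

lemma IsPowerTorsion.exists_pow_smul_eq_zero [IsNoetherianRing R] (h : IsPowerTorsion 𝔞 M)
    (m : M) : ∃ n, ∀ a ∈ 𝔞 ^ n, a • m = 0 := by
  obtain ⟨n, hn⟩ := Ideal.exists_pow_le_of_le_radical_of_fg (h m) (IsNoetherian.noetherian 𝔞)
  exact ⟨n, fun a ha ↦ hn ha⟩

lemma IsPowerTorsion.of_forall_exists (h : ∀ m : M, ∃ n, ∀ a ∈ 𝔞 ^ n, a • m = 0) :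
    IsPowerTorsion 𝔞 M := fun m a ha ↦ by
  obtain ⟨n, hn⟩ := h m
  exact ⟨n, hn _ (Ideal.pow_mem_pow ha n)⟩

lemma isPowerTorsion_iff :
    IsPowerTorsion 𝔞 M ↔ ∀ (m : M), ∀ a ∈ 𝔞, ∃ n : ℕ, a ^ n • m = 0 := Iff.rfl

lemma IsPowerTorsion.mono (h : IsPowerTorsion 𝔞 M) (hab : 𝔟 ≤ 𝔞) : IsPowerTorsion 𝔟 M :=
  fun m ↦ hab.trans (h m)

lemma IsPowerTorsion.sup (h : IsPowerTorsion 𝔞 M) (h' : IsPowerTorsion 𝔟 M) :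
    IsPowerTorsion (𝔞 ⊔ 𝔟) M :=
  fun m ↦ sup_le (h m) (h' m)

lemma isPowerTorsion_span_singleton {x : R} (h : ∀ m : M, ∃ n : ℕ, x ^ n • m = 0) :
    IsPowerTorsion (Ideal.span {x}) M := fun m ↦ by
  rw [Ideal.span_singleton_le_iff_mem]
  exact h m

lemma isPowerTorsion_bot : IsPowerTorsion (⊥ : Ideal R) M := fun _ ↦ bot_le

lemma IsPowerTorsion.of_injective (h : IsPowerTorsion 𝔞 N) (f : M →ₗ[R] N)
    (hf : Function.Injective f) : IsPowerTorsion 𝔞 M := by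
  rw [isPowerTorsion_iff] at h ⊢
  intro m a ha
  obtain ⟨n, hn⟩ := h (f m) a ha
  exact ⟨n, hf (by rw [map_smul, hn, map_zero])⟩

lemma IsPowerTorsion.of_surjective (h : IsPowerTorsion 𝔞 M) (f : M →ₗ[R] N)
    (hf : Function.Surjective f) : IsPowerTorsion 𝔞 N := by
  rw [isPowerTorsion_iff] at h ⊢
  intro m a ha
  obtain ⟨m, rfl⟩ := hf m
  obtain ⟨n, hn⟩ := h m a ha
  exact ⟨n, by rw [← map_smul, hn, map_zero]⟩

variable (𝔞) in
lemma isPowerTorsion_primaryComponent : IsPowerTorsion 𝔞 (Ideal.primaryComponent M 𝔞) := by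
  refine .of_forall_exists fun ⟨m, hm⟩ ↦ ?_
  obtain ⟨n, hn⟩ := (Ideal.primaryComponent_mem _ _ _).1 hm
  exact ⟨n, fun a ha ↦ Subtype.ext ((Submodule.mem_torsionBySet_iff _ _).1 hn ⟨a, ha⟩)⟩

variable (𝔞) in
lemma baer_primaryComponent [IsNoetherianRing R] (hM : Module.Baer R M) :
    Module.Baer R (Ideal.primaryComponent M 𝔞) := by
  intro I g
  obtain ⟨k, hk⟩ : ∃ k, ∀ a ∈ 𝔞 ^ k, ∀ x, a • g x = 0 := by
    have hfg : g.range.FG := by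
      rw [LinearMap.range_eq_map]
      exact Module.Finite.fg_top.map g
    have hrad : 𝔞 ≤ (g.range).annihilator.radical := by
      intro a ha
      obtain ⟨s, hs⟩ := hfg
      choose n hn using fun m ↦ isPowerTorsion_iff.1 (isPowerTorsion_primaryComponent 𝔞 (M := M))
        m a ha
      refine ⟨s.sup n, ?_⟩
      rw [← hs, Submodule.mem_annihilator_span]
      rintro ⟨m, hm⟩
      obtain ⟨c, hc⟩ := Nat.exists_eq_add_of_le (Finset.le_sup (f := n) hm)
      rw [hc, add_comm, pow_add, mul_smul, hn, smul_zero]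
    obtain ⟨k, hk⟩ := Ideal.exists_pow_le_of_le_radical_of_fg hrad (IsNoetherian.noetherian 𝔞)
    exact ⟨k, fun a ha x ↦ Submodule.mem_annihilator.1 (hk ha) _ ⟨x, rfl⟩⟩
  obtain ⟨k₀, hk₀⟩ := Ideal.exists_pow_inf_eq_pow_smul 𝔞 (I : Submodule R R)
  specialize hk₀ (k + k₀) (by lia)
  let π : I →ₗ[R] R ⧸ 𝔞 ^ (k + k₀) := (𝔞 ^ (k + k₀)).mkQ ∘ₗ I.subtype
  have hπ : π.ker ≤ ((Ideal.primaryComponent M 𝔞).subtype ∘ₗ g).ker := by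
    rintro ⟨x, hx⟩ hxπ
    have hx' : x ∈ 𝔞 ^ (k + k₀) := (Submodule.Quotient.mk_eq_zero _).1 hxπ
    have hmem : x ∈ 𝔞 ^ (k + k₀) • (⊤ : Submodule R R) ⊓ I := ⟨by simpa using hx', hx⟩
    rw [hk₀, Nat.add_sub_cancel] at hmem
    have hle : 𝔞 ^ k • (𝔞 ^ k₀ • (⊤ : Submodule R R) ⊓ I) ≤ (g.ker).map I.subtype := by
      rw [Submodule.smul_le]
      rintro a ha y ⟨-, hy⟩
      refine ⟨a • ⟨y, hy⟩, ?_, rfl⟩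
      rw [SetLike.mem_coe, LinearMap.mem_ker, map_smul, hk a ha]
    obtain ⟨z, hz, hzx⟩ := hle hmem
    obtain rfl : z = ⟨x, hx⟩ := Subtype.ext hzx
    rw [LinearMap.mem_ker, LinearMap.comp_apply, LinearMap.mem_ker.1 hz, map_zero]
  obtain ⟨h, hh⟩ := hM.extension_property (π.ker.liftQ π le_rfl)
    (LinearMap.ker_eq_bot.1 (Submodule.ker_liftQ_eq_bot _ _ _ le_rfl)) (π.ker.liftQ _ hπ)
  refine ⟨(h ∘ₗ (𝔞 ^ (k + k₀)).mkQ).codRestrict _ fun r ↦ ?_, fun x hx ↦ Subtype.ext ?_⟩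
  · refine (Ideal.primaryComponent_mem _ _ _).2 ⟨k + k₀, ?_⟩
    rw [Submodule.mem_torsionBySet_iff]
    rintro ⟨a, ha⟩
    change a • h ((𝔞 ^ (k + k₀)).mkQ r) = 0
    have : (𝔞 ^ (k + k₀)).mkQ (a • r) = 0 :=
      (Submodule.Quotient.mk_eq_zero _).2 (Ideal.mul_mem_right _ _ ha)
    rw [← map_smul, ← map_smul, this, map_zero]
  · exact congr($hh (Submodule.Quotient.mk ⟨x, hx⟩))

lemma subsingleton_H_succ_of_baer (hM : Module.Baer R M) (i : ℕ) :
    Subsingleton (H 𝔞 M (i + 1)) := by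
  have := hM.injective
  have := Module.injective_object_of_injective_module R M
  exact subsingleton_H_of_forall_ext fun n ↦ Ext.subsingleton_of_injective _ _ _

variable (M) in
lemma exists_injective_baer : ∃ (E : Type u) (_ : AddCommGroup E) (_ : Module R E)
    (f : M →ₗ[R] E), Function.Injective f ∧ Module.Baer R E := by
  let E := Injective.under (ModuleCat.of R M)
  refine ⟨E, inferInstance, inferInstance, (Injective.ι (ModuleCat.of R M)).hom,
    (ModuleCat.mono_iff_injective _).1 inferInstance, ?_⟩
  have : Injective (ModuleCat.of R E) := inferInstanceAs (Injective (Injective.under _))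
  exact .of_injective (Module.injective_module_of_injective_object R E)

lemma IsPowerTorsion.exists_injective_baer [IsNoetherianRing R] (h : IsPowerTorsion 𝔞 M) :
    ∃ (E : Type u) (_ : AddCommGroup E) (_ : Module R E) (f : M →ₗ[R] E),
      Function.Injective f ∧ Module.Baer R E ∧ IsPowerTorsion 𝔞 E := by
  obtain ⟨E, _, _, f, hf, hE⟩ := localCohomology.exists_injective_baer (R := R) M
  refine ⟨Ideal.primaryComponent E 𝔞, inferInstance, inferInstance,
    f.codRestrict _ fun m ↦ (Ideal.primaryComponent_mem _ _ _).2 ?_, ?_,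
    baer_primaryComponent 𝔞 hE, isPowerTorsion_primaryComponent 𝔞⟩
  · obtain ⟨n, hn⟩ := h.exists_pow_smul_eq_zero m
    refine ⟨n, ?_⟩
    rw [Submodule.mem_torsionBySet_iff]
    rintro ⟨a, ha⟩
    change a • f m = 0
    rw [← map_smul, hn a ha, map_zero]
  · exact fun x y hxy ↦ hf congr(($hxy).1)

lemma mapH_zero_surjective [IsNoetherianRing R] (h : IsPowerTorsion 𝔞 M) {f : M →ₗ[R] N}
    (hf : Function.Surjective f) : Function.Surjective (mapH 𝔞 0 f) := by
  intro y
  obtain ⟨n, α, rfl⟩ := ofExt_surjective y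
  obtain ⟨φ, rfl⟩ := (Ext.mk₀_bijective _ _).2 α
  obtain ⟨x, hx⟩ := hf (φ.hom (Ideal.Quotient.mk _ 1))
  obtain ⟨k, hk⟩ := h.exists_pow_smul_eq_zero x
  let ψ : quotPow 𝔞 (n + k) ⟶ ModuleCat.of R M := ModuleCat.ofHom
    ((𝔞 ^ (n + k)).liftQ (LinearMap.toSpanSingleton R M x) fun a ha ↦
      hk a (Ideal.pow_le_pow_right (Nat.le_add_left k n) ha))
  refine ⟨ofExt (n + k) (Ext.mk₀ ψ), ?_⟩
  rw [mapH, map_ofExt, Ext.mk₀_comp_mk₀, ← ofExt_quotPowMap (Nat.le_add_right n k),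
    Ext.mk₀_comp_mk₀]
  congr 2
  ext
  change f ((1 : R) • x) = φ.hom (Ideal.Quotient.mk _ 1)
  rw [one_smul, hx]

lemma IsPowerTorsion.subsingleton_H_succ [IsNoetherianRing R] (h : IsPowerTorsion 𝔞 M) (i : ℕ) :
    Subsingleton (H 𝔞 M (i + 1)) := by
  induction i generalizing M with
  | zero =>
    obtain ⟨E, _, _, f, hf, hE, hE'⟩ := h.exists_injective_baer
    obtain ⟨δ, hδ, hδ'⟩ := exists_connecting_mapH (𝔞 := 𝔞) hf f.range.mkQ_surjective
      (LinearMap.exact_map_mkQ_range f) 0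
    have := subsingleton_H_succ_of_baer (𝔞 := 𝔞) hE 0
    refine subsingleton_of_forall_eq 0 fun x ↦ ?_
    obtain ⟨y, rfl⟩ := (hδ' x).1 (Subsingleton.elim _ _)
    exact (hδ y).2 (mapH_zero_surjective hE' f.range.mkQ_surjective y)
  | succ i ih =>
    obtain ⟨E, _, _, f, hf, hE, hE'⟩ := h.exists_injective_baer
    exact subsingleton_H_left hf f.range.mkQ_surjective (LinearMap.exact_map_mkQ_range f)
      (ih (hE'.of_surjective _ f.range.mkQ_surjective)) (subsingleton_H_succ_of_baer hE _)

lemma subsingleton_H_of_bijective_smul {x : R} (hx : x ∈ 𝔞)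
    (hM : Function.Bijective fun m : M ↦ x • m) (i : ℕ) : Subsingleton (H 𝔞 M i) := by
  refine subsingleton_H_of_forall_ext fun n ↦ subsingleton_of_forall_eq 0 fun α ↦ ?_
  have hz : x ^ n • 𝟙 (quotPow 𝔞 n) = 0 := by
    ext
    exact Ideal.Quotient.eq_zero_iff_mem.2 (Ideal.mul_mem_right _ _ (Ideal.pow_mem_pow hx n))
  have h0 : x ^ n • α = 0 := by
    rw [← Ext.mk₀_id_comp α, ← Ext.smul_comp, ← Ext.mk₀_smul, hz, Ext.mk₀_zero, Ext.zero_comp]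
  have hbij : Function.Bijective (LinearMap.lsmul R M (x ^ n)) := by
    have : ⇑(LinearMap.lsmul R M (x ^ n)) = (fun m : M ↦ x • m)^[n] := by
      ext m
      simp [smul_iterate_apply]
    rw [this]
    exact hM.iterate n
  let e : ModuleCat.of R M ≅ ModuleCat.of R M := (LinearEquiv.ofBijective _ hbij).toModuleIso
  have he : e.hom = x ^ n • 𝟙 _ := rfl
  rw [Ext.smul_eq_comp_mk₀, ← he] at h0
  rw [← Ext.comp_mk₀_id α, ← e.hom_inv_id, ← Ext.mk₀_comp_mk₀,
    ← Ext.comp_assoc_of_third_deg_zero, h0, Ext.zero_comp]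

lemma subsingleton_H_of_isPowerTorsion_of_card_lt [IsNoetherianRing R] (s : Finset R)
    (hs : (s : Set R) ⊆ 𝔞) (h𝔞 : 𝔞 ≤ 𝔟 ⊔ Ideal.span s) (hM : IsPowerTorsion 𝔟 M) {i : ℕ}
    (hi : s.card < i) : Subsingleton (H 𝔞 M i) := by
  classical
  induction s using Finset.induction_on generalizing M 𝔟 i with
  | empty =>
    obtain ⟨i, rfl⟩ := Nat.exists_eq_succ_of_ne_zero (Nat.ne_zero_of_lt hi)
    exact (hM.mono (by simpa using h𝔞)).subsingleton_H_succ i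
  | insert x s hxs ih =>
    rw [Finset.card_insert_of_notMem hxs] at hi
    obtain ⟨i, rfl⟩ := Nat.exists_eq_succ_of_ne_zero (Nat.ne_zero_of_lt hi)
    rw [Finset.coe_insert, Set.insert_subset_iff] at hs
    rw [Finset.coe_insert, Ideal.span_insert, ← sup_assoc] at h𝔞
    let S := Submonoid.powers x
    let f : M →ₗ[R] LocalizedModule S M := LocalizedModule.mkLinearMap S M
    have hbij : Function.Bijective fun m : LocalizedModule S M ↦ x • m :=
      (Module.End.isUnit_iff _).1 (IsLocalizedModule.map_units f ⟨x, Submonoid.mem_powers x⟩)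
    have htors : IsPowerTorsion 𝔟 (LocalizedModule S M) := by
      rw [isPowerTorsion_iff]
      intro m a ha
      obtain ⟨⟨m, t⟩, rfl⟩ := IsLocalizedModule.mk'_surjective S f m
      obtain ⟨n, hn⟩ := isPowerTorsion_iff.1 hM m a ha
      exact ⟨n, by rw [Function.uncurry_apply_pair, ← IsLocalizedModule.mk'_smul, hn,
        IsLocalizedModule.mk'_zero]⟩
    have hK : Subsingleton (H 𝔞 f.ker (i + 1)) := by
      refine ih hs.2 h𝔞 ((hM.of_injective _ f.ker.injective_subtype).sup
        (isPowerTorsion_span_singleton fun m ↦ ?_)) (by lia)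
      obtain ⟨⟨_, n, rfl⟩, hn⟩ := (IsLocalizedModule.eq_zero_iff S f).1 m.2
      exact ⟨n, Subtype.ext hn⟩
    have hL : Subsingleton (H 𝔞 (LocalizedModule S M ⧸ f.range) i) := by
      refine ih hs.2 h𝔞 ((htors.of_surjective _ f.range.mkQ_surjective).sup
        (isPowerTorsion_span_singleton fun m ↦ ?_)) (by lia)
      obtain ⟨m, rfl⟩ := f.range.mkQ_surjective m
      obtain ⟨⟨m', ⟨_, n, rfl⟩⟩, hn⟩ := IsLocalizedModule.surj S f m
      refine ⟨n, ?_⟩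
      rw [← map_smul]
      exact (Submodule.Quotient.mk_eq_zero _).2 ⟨m', hn.symm⟩
    have hI : Subsingleton (H 𝔞 f.range (i + 1)) :=
      subsingleton_H_left f.range.injective_subtype f.range.mkQ_surjective
        (LinearMap.exact_subtype_mkQ _) hL (subsingleton_H_of_bijective_smul hs.1 hbij _)
    exact subsingleton_H_middle f.ker.injective_subtype f.surjective_rangeRestrict
      (by rw [LinearMap.exact_iff, LinearMap.ker_rangeRestrict, Submodule.range_subtype]) hK hI

variable (𝔞) in
/-- Local cohomology over a Noetherian ring vanishes in large degrees. -/
lemma exists_forall_subsingleton_H [IsNoetherianRing R] :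
    ∃ n : ℕ, ∀ (M : Type u) [AddCommGroup M] [Module R M], ∀ i, n < i →
      Subsingleton (H 𝔞 M i) := by
  obtain ⟨s, hs⟩ := IsNoetherian.noetherian 𝔞
  refine ⟨s.card, fun M _ _ i hi ↦ ?_⟩
  refine subsingleton_H_of_isPowerTorsion_of_card_lt (𝔟 := ⊥) s ?_ ?_ isPowerTorsion_bot hi
  · rw [← hs]
    exact Submodule.subset_span
  · rw [← hs]
    exact le_sup_right

end localCohomology

open scoped TensorProduct

/-- A finite module has a nonzero map to `R ⧸ 𝔭` for every prime `𝔭` in its support. -/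
lemma Module.exists_linearMap_quotient_ne_zero {R M : Type*} [CommRing R] [AddCommGroup M]
    [Module R M] [Module.Finite R M] {𝔭 : PrimeSpectrum R} (h𝔭 : 𝔭 ∈ Module.support R M) :
    ∃ f : M →ₗ[R] R ⧸ 𝔭.asIdeal, f ≠ 0 := by
  classical
  let κ := 𝔭.asIdeal.ResidueField
  let A := R ⧸ 𝔭.asIdeal
  have : Nontrivial (κ ⊗[R] M) := (mem_support_iff_nontrivial_residueField_tensorProduct 𝔭).1 h𝔭
  obtain ⟨v, hv⟩ := exists_ne (0 : κ ⊗[R] M)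
  obtain ⟨φ, hφ⟩ := not_forall.1 (mt (forall_dual_apply_eq_zero_iff κ v).1 hv)
  let g : M →ₗ[R] κ := φ.restrictScalars R ∘ₗ TensorProduct.mk R κ M 1
  have hg : ∃ m, g m ≠ 0 := by
    by_contra! h
    suffices ∀ w, φ w = 0 from hφ (this v)
    intro w
    induction w with
    | zero => exact map_zero φ
    | add x y hx hy => rw [map_add, hx, hy, add_zero]
    | tmul c m =>
      rw [← mul_one c, ← smul_eq_mul, ← TensorProduct.smul_tmul', map_smul]
      exact (congrArg (c • ·) (h m)).trans (smul_zero c)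
  obtain ⟨m, hm⟩ := hg
  obtain ⟨s, hs⟩ := Module.Finite.fg_top (R := R) (M := M)
  obtain ⟨b, hb⟩ := IsLocalization.exist_integer_multiples_of_finset (nonZeroDivisors A)
    (s.image g)
  obtain ⟨r, hr⟩ := Ideal.Quotient.mk_surjective (b : A)
  let ι : A →ₗ[R] κ := (Algebra.linearMap A κ).restrictScalars R
  have hι : Function.Injective ι := IsFractionRing.injective A κ
  have hrange : ∀ x, (r • g) x ∈ LinearMap.range ι := by
    have : (⊤ : Submodule R M) ≤ (LinearMap.range ι).comap (r • g) := by
      rw [← hs, Submodule.span_le]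
      intro x hx
      obtain ⟨a, ha⟩ := hb (g x) (Finset.mem_image_of_mem g hx)
      refine ⟨a, ha.trans ?_⟩
      rw [LinearMap.smul_apply, ← hr]
      exact algebraMap_smul A r (g x)
    exact fun x ↦ this trivial
  refine ⟨(LinearEquiv.ofInjective ι hι).symm ∘ₗ (r • g).codRestrict _ hrange, fun h ↦ ?_⟩
  have h0 : (r • g) m = 0 := by
    have := congrArg (LinearEquiv.ofInjective ι hι) (LinearMap.congr_fun h m)
    simpa using congrArg Subtype.val this
  rw [LinearMap.smul_apply, ← algebraMap_smul A r (g m), Ideal.Quotient.algebraMap_eq, hr] at h0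
  rcases smul_eq_zero.1 h0 with h1 | h1
  · exact nonZeroDivisors.coe_ne_zero b h1
  · exact hm h1

lemma PrimeSpectrum.mem_support_quotient_iff {R : Type*} [CommRing R] {𝔭 𝔮 : PrimeSpectrum R} :
    𝔮 ∈ Module.support R (R ⧸ 𝔭.asIdeal) ↔ 𝔭 ≤ 𝔮 := by
  rw [Module.mem_support_iff_of_finite, Ideal.annihilator_quotient]
  rfl

namespace localCohomology

lemma isArtinian_H_of_subsingleton {R : Type u} [CommRing R] {𝔞 : Ideal R} {M : Type u}
    [AddCommGroup M] [Module R M] [Subsingleton M] (i : ℕ) : IsArtinian R (H 𝔞 M i) :=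
  have : Subsingleton (H 𝔞 M i) := subsingleton_H_of_bijective_smul (zero_mem 𝔞)
    ⟨fun _ _ _ ↦ Subsingleton.elim _ _, fun m ↦ ⟨m, Subsingleton.elim _ _⟩⟩ i
  inferInstance

variable {R : Type u} [CommRing R] [IsNoetherianRing R] {𝔞 : Ideal R}
  {M N : Type u} [AddCommGroup M] [Module R M] [Module.Finite R M]
  [AddCommGroup N] [Module R N] [Module.Finite R N]

/-- Reduction of Artinianness of local cohomology to cyclic modules defined by primes. -/
lemma isArtinian_H_of_forall_mem_support {i : ℕ}
    (h : ∀ 𝔭 ∈ Module.support R M, IsArtinian R (H 𝔞 (R ⧸ 𝔭.asIdeal) i)) :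
    IsArtinian R (H 𝔞 M i) := by
  induction ‹Module.Finite R M› using IsNoetherianRing.induction_on_isQuotientEquivQuotientPrime R
  case subsingleton => exact isArtinian_H_of_subsingleton i
  case quotient N _ _ _ 𝔭 e =>
    have := h 𝔭 (e.support_eq ▸ PrimeSpectrum.mem_support_quotient_iff.2 le_rfl)
    exact isArtinian_of_linearEquiv (equivH e i).symm
  case exact N₁ _ _ _ N₂ _ _ _ N₃ _ _ _ f g hf hg hfg ih₁ ih₃ =>
    rw [Module.support_of_exact hfg hf hg] at h
    exact isArtinian_H_middle hf hg hfg (ih₁ fun 𝔭 h𝔭 ↦ h 𝔭 (.inl h𝔭))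
      (ih₃ fun 𝔭 h𝔭 ↦ h 𝔭 (.inr h𝔭))

/-- Descending step: Artinianness passes from `N` to quotients by primes in its support. -/
lemma isArtinian_H_quotient_of_mem_support {i : ℕ} (hN : IsArtinian R (H 𝔞 N i))
    (ih : ∀ (M : Type u) [AddCommGroup M] [Module R M] [Module.Finite R M],
      Module.support R M ⊆ Module.support R N → IsArtinian R (H 𝔞 M (i + 1)))
    (𝔭 : PrimeSpectrum R) (h𝔭 : 𝔭 ∈ Module.support R N) :
    IsArtinian R (H 𝔞 (R ⧸ 𝔭.asIdeal) i) := by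
  have : WellFoundedGT (PrimeSpectrum R) :=
    StrictMono.wellFoundedGT (f := PrimeSpectrum.asIdeal) fun _ _ h ↦ h
  induction 𝔭 using WellFoundedGT.induction with
  | ind 𝔭 ih𝔭 =>
  obtain ⟨f, hf⟩ := Module.exists_linearMap_quotient_ne_zero h𝔭
  have hI : IsArtinian R (H 𝔞 f.range i) :=
    isArtinian_H_right f.ker.injective_subtype f.surjective_rangeRestrict
      (by rw [LinearMap.exact_iff, LinearMap.ker_rangeRestrict, Submodule.range_subtype]) hN
      (ih f.ker (Module.support_subset_of_injective _ f.ker.injective_subtype))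
  refine isArtinian_H_middle f.range.injective_subtype f.range.mkQ_surjective
    (LinearMap.exact_subtype_mkQ _) hI (isArtinian_H_of_forall_mem_support fun 𝔮 h𝔮 ↦ ?_)
  have hle : 𝔭 ≤ 𝔮 := PrimeSpectrum.mem_support_quotient_iff.1
    (Module.support_subset_of_surjective _ f.range.mkQ_surjective h𝔮)
  refine ih𝔭 𝔮 (lt_of_le_of_ne hle ?_) (Module.mem_support_mono hle h𝔭)
  rintro rfl
  obtain ⟨m, hm⟩ := DFunLike.ne_iff.1 hf
  obtain ⟨a, ha⟩ := Ideal.Quotient.mk_surjective (f m)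
  have ha' : a ∈ Module.annihilator R ((R ⧸ 𝔭.asIdeal) ⧸ f.range) := by
    rw [Module.mem_annihilator]
    intro x
    obtain ⟨y, rfl⟩ := f.range.mkQ_surjective x
    obtain ⟨c, rfl⟩ := Ideal.Quotient.mk_surjective y
    rw [← map_smul]
    refine (Submodule.Quotient.mk_eq_zero _).2 ⟨c • m, ?_⟩
    rw [map_smul, ← ha]
    simp only [Algebra.smul_def, Ideal.Quotient.algebraMap_eq]
    exact mul_comm _ _
  refine hm (ha.symm.trans (Ideal.Quotient.eq_zero_iff_mem.2 ?_))
  exact Module.annihilator_le_of_mem_support h𝔮 ha'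

lemma isArtinian_H_of_support_subset {s : ℕ} (hN : ∀ i, s ≤ i → IsArtinian R (H 𝔞 N i))
    (hM : Module.support R M ⊆ Module.support R N) {i : ℕ} (hi : s ≤ i) :
    IsArtinian R (H 𝔞 M i) := by
  obtain ⟨n, hn⟩ := exists_forall_subsingleton_H 𝔞
  have key (k : ℕ) : ∀ (M : Type u) [AddCommGroup M] [Module R M] [Module.Finite R M],
      Module.support R M ⊆ Module.support R N → ∀ i, s ≤ i → n < i + k →
        IsArtinian R (H 𝔞 M i) := by
    induction k with
    | zero =>
      intro M _ _ _ _ i _ hk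
      have := hn M i hk
      infer_instance
    | succ k ih =>
      intro M _ _ _ hM i hi hk
      exact isArtinian_H_of_forall_mem_support fun 𝔭 h𝔭 ↦
        isArtinian_H_quotient_of_mem_support (hN i hi)
          (fun M' _ _ _ hM' ↦ ih M' hM' (i + 1) (by lia) (by lia)) 𝔭 (hM h𝔭)
  exact key (n + 1) M hM i hi (by lia)

variable (𝔞 N) in
lemma forall_isArtinian_H_iff (s : ℕ) : (∀ i, s ≤ i → IsArtinian R (H 𝔞 N i)) ↔
    ∀ 𝔭 ∈ Module.support R N, ∀ i, s ≤ i → IsArtinian R (H 𝔞 (R ⧸ 𝔭.asIdeal) i) :=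
  ⟨fun h _ h𝔭 _ hi ↦ isArtinian_H_of_support_subset h 
      (fun _ h𝔮 ↦ Module.mem_support_mono (PrimeSpectrum.mem_support_quotient_iff.1 h𝔮) h𝔭) hi,
    fun h i hi ↦ isArtinian_H_of_forall_mem_support fun 𝔭 h𝔭 ↦ h 𝔭 h𝔭 i hi⟩

end localCohomology

end

theorem artinianness_dim_eq_sup_over_support
    {R : Type u} [CommRing R] [IsNoetherianRing R] (𝔞 : Ideal R)
    (N : Type u) [AddCommGroup N] [Module R N] [Module.Finite R N] :
    (sSup ((fun i : ℕ => (i : WithBot ℕ∞)) ''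
        { i : ℕ | ¬ IsArtinian R ((localCohomology 𝔞 i).obj (ModuleCat.of R N)) }) =
      ⨆ 𝔭 ∈ Module.support R N,
        sSup ((fun i : ℕ => (i : WithBot ℕ∞)) ''
          { i : ℕ | ¬ IsArtinian R
              ((localCohomology 𝔞 i).obj (ModuleCat.of R (R ⧸ 𝔭.asIdeal))) })) ∧
    ∀ t : ℕ,
      (∀ i, t < i → IsArtinian R ((localCohomology 𝔞 i).obj (ModuleCat.of R N))) ↔
        ∀ 𝔭 ∈ Module.support R N, ∀ i, t < i →
          IsArtinian R ((localCohomology 𝔞 i).obj (ModuleCat.of R (R ⧸ 𝔭.asIdeal))) := by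
  refine ⟨le_antisymm (sSup_le ?_) (iSup₂_le fun 𝔭 h𝔭 ↦ sSup_le ?_),
    fun t ↦ localCohomology.forall_isArtinian_H_iff 𝔞 N (t + 1)⟩
  · rintro _ ⟨i, hi, rfl⟩
    have := mt (fun h ↦ (localCohomology.forall_isArtinian_H_iff 𝔞 N i).2 h i le_rfl) hi
    push Not at this
    obtain ⟨𝔭, h𝔭, j, hij, hj⟩ := this
    exact (Nat.mono_cast hij).trans
      ((le_sSup (Set.mem_image_of_mem _ hj)).trans (le_iSup₂_of_le 𝔭 h𝔭 le_rfl))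
  · rintro _ ⟨i, hi, rfl⟩
    have := mt (fun h ↦ (localCohomology.forall_isArtinian_H_iff 𝔞 N i).1 h 𝔭 h𝔭 i le_rfl) hi
    push Not at this
    obtain ⟨j, hij, hj⟩ := this
    exact (Nat.mono_cast hij).trans (le_sSup (Set.mem_image_of_mem _ hj))
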